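/- arXiv:0707.3607 — 2 statements merged into one kernel-verified Lean document; each statement's English description precedes it below -/
import Mathlib

section
/- Let Γ be a finite generalized layered graph, let v,w be vertices with |v| > |w|, and let Γ^e be obtained from Γ by adjoining a new edge e with t(e) = v, h(e) = w. Then M(Γ^e)(z) − M(Γ)(z) = Σ (−1)^{l+m+1} z^{|v_1| − |w_m|}, where the sum is over all pairs of chains v_1 > v_2 > ⋯ > v_l and w_1 > w_2 > ⋯ > w_m (l, m ≥ 1) in the poset of Γ such that v_l ≥ v, w ≥ w_1, and there is no directed path in Γ from v_l to w_1. -/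
open scoped BigOperators

namespace GLG

variable {V E : Type}

def len (tl hd : E → V) (rk : V → ℕ) (e : E) : ℕ := rk (tl e) - rk (hd e)
def IsRank (tl hd : E → V) (rk : V → ℕ) : Prop := ∀ e : E, rk (hd e) < rk (tl e)
def IsPathC (tl hd : E → V) (e : E) (es : List E) : Prop :=
  List.Chain (fun a b => hd a = tl b) e es
def pathDst (hd : E → V) (e : E) (es : List E) : V :=
  hd ((e :: es).getLast (List.cons_ne_nil e es))
def Reaches (tl hd : E → V) (v w : V) : Prop :=
  ∃ (e : E) (es : List E), IsPathC tl hd e es ∧ tl e = v ∧ pathDst hd e es = w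

/-- The set `E^♯` of generators `a_i(e)`, `1 ≤ i ≤ l(e)`. -/
abbrev ESharp (tl hd : E → V) (rk : V → ℕ) : Type :=
  Σ e : E, {i : ℕ // 1 ≤ i ∧ i ≤ len tl hd rk e}

/-- `P_e(t) = 1 + Σ_{j=1}^{l(e)} (-1)^j a_j(e) t^j`. -/
noncomputable def Pe (F : Type) [Field F] (tl hd : E → V) (rk : V → ℕ) (e : E) :
    Polynomial (FreeAlgebra F (ESharp tl hd rk)) :=
  1 + ∑ j ∈ (Finset.Icc 1 (len tl hd rk e)).attach,
      Polynomial.C ((-1 : FreeAlgebra F (ESharp tl hd rk)) ^ (j : ℕ) *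
        FreeAlgebra.ι F (⟨e, ⟨(j : ℕ), (Finset.mem_Icc.mp j.2).1, (Finset.mem_Icc.mp j.2).2⟩⟩ :
          ESharp tl hd rk)) *
      Polynomial.X ^ (j : ℕ)

/-- `e(π, j)`, the coefficient of `(-t)^j` in `P_π(t) = P_{e₁}(t) ⋯ P_{e_r}(t)`,
for `π` the path given by the list of edges `es`. -/
noncomputable def eP (F : Type) [Field F] (tl hd : E → V) (rk : V → ℕ)
    (es : List E) (j : ℕ) : FreeAlgebra F (ESharp tl hd rk) :=
  (-1 : FreeAlgebra F (ESharp tl hd rk)) ^ j * ((es.map (Pe F tl hd rk)).prod).coeff j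

/-- The defining relations of `A(Γ)`: `e(π₁,j) = e(π₂,j)` for paths `π₁, π₂` with the same
tail and the same head, and `1 ≤ j ≤ l(π₁)`. -/
def rel (F : Type) [Field F] (tl hd : E → V) (rk : V → ℕ) :
    FreeAlgebra F (ESharp tl hd rk) → FreeAlgebra F (ESharp tl hd rk) → Prop :=
  fun x y => ∃ (e1 : E) (es1 : List E) (e2 : E) (es2 : List E) (j : ℕ),
    IsPathC tl hd e1 es1 ∧ IsPathC tl hd e2 es2 ∧
    tl e1 = tl e2 ∧ pathDst hd e1 es1 = pathDst hd e2 es2 ∧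
    1 ≤ j ∧ j ≤ rk (tl e1) - rk (pathDst hd e1 es1) ∧
    x = eP F tl hd rk (e1 :: es1) j ∧ y = eP F tl hd rk (e2 :: es2) j

/-- The algebra `A(Γ) = T(E^♯)/R`. -/
noncomputable abbrev AGamma (F : Type) [Field F] (tl hd : E → V) (rk : V → ℕ) : Type :=
  RingQuot (rel F tl hd rk)

/-- The canonical projection `T(E^♯) → A(Γ)`. -/
noncomputable def mkA (F : Type) [Field F] (tl hd : E → V) (rk : V → ℕ) :
    FreeAlgebra F (ESharp tl hd rk) →ₐ[F] AGamma F tl hd rk :=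
  RingQuot.mkAlgHom F (rel F tl hd rk)

/-- `f(a,j) = ja - j(j-1)/2`. -/
def fN (a j : ℕ) : ℕ := j * a - j * (j - 1) / 2

/-- The filtration weight `|a_i(e)| = f(|t(e)|, i)` of a generator. -/
def wt (tl hd : E → V) (rk : V → ℕ) (s : ESharp tl hd rk) : ℕ := fN (rk (tl s.1)) s.2.1

/-- The filtration subspace `A(Γ)_n`: the span of the images of the products of generators
of total weight at most `n`. -/
noncomputable def filt (F : Type) [Field F] (tl hd : E → V) (rk : V → ℕ) (n : ℕ) :
    Submodule F (AGamma F tl hd rk) :=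
  Submodule.span F {x : AGamma F tl hd rk | ∃ w : List (ESharp tl hd rk),
    (w.map (wt tl hd rk)).sum ≤ n ∧ x = mkA F tl hd rk ((w.map (FreeAlgebra.ι F)).prod)}

/-- The degree-`n` homogeneous component `A(Γ)_{[n]}` (for the grading with `deg a_i(e) = i`):
the image in `A(Γ)` of the span of the words of total degree `n`. -/
noncomputable def gpiece (F : Type) [Field F] (tl hd : E → V) (rk : V → ℕ) (n : ℕ) :
    Submodule F (AGamma F tl hd rk) :=
  Submodule.span F {x : AGamma F tl hd rk | ∃ w : List (ESharp tl hd rk),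
    (w.map (fun s => s.2.1)).sum = n ∧ x = mkA F tl hd rk ((w.map (FreeAlgebra.ι F)).prod)}

/-- The Hilbert series `H(A(Γ), z) = Σ_n dim_F A(Γ)_{[n]} · z^n ∈ ℤ[[z]]`. -/
noncomputable def hilb (F : Type) [Field F] (tl hd : E → V) (rk : V → ℕ) : PowerSeries ℤ :=
  PowerSeries.mk fun n => (Module.finrank F (gpiece F tl hd rk n) : ℤ)


/-- `v ≥ w` in the poset of the graph. -/
def GE (tl hd : E → V) (v w : V) : Prop := v = w ∨ Reaches tl hd v w

/-- The Möbius function of the poset of the graph: the sum of `(-1)^(l+1)` over all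
chains `v = v₁ > v₂ > ⋯ > v_l = w`. -/
noncomputable def mob (tl hd : E → V) (v w : V) : ℤ :=
  ∑ᶠ c ∈ {c : List V | c.Chain' (Reaches tl hd) ∧ c.head? = some v ∧ c.getLast? = some w},
    (-1 : ℤ) ^ (c.length + 1)

/-- `M(Γ)(z) = Σ_{v ≥ w} μ(v,w) z^{|v|-|w|}`, as a formal power series over `ℤ`. -/
noncomputable def MGamma (tl hd : E → V) (rk : V → ℕ) : PowerSeries ℤ :=
  ∑ᶠ p ∈ {p : V × V | GE tl hd p.1 p.2},
    mob tl hd p.1 p.2 • (PowerSeries.X : PowerSeries ℤ) ^ (rk p.1 - rk p.2)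

/-- `M_∘(Γ)(z) = Σ_{x ∈ V} μ(x, v_min) z^{|x|-|v_min|}`. -/
noncomputable def MLow (tl hd : E → V) (rk : V → ℕ) (vmin : V) : PowerSeries ℤ :=
  ∑ᶠ x : V, mob tl hd x vmin • (PowerSeries.X : PowerSeries ℤ) ^ (rk x - rk vmin)

noncomputable def MUp (tl hd : E → V) (rk : V → ℕ) (vmax : V) : PowerSeries ℤ :=
  ∑ᶠ x : V, mob tl hd vmax x • (PowerSeries.X : PowerSeries ℤ) ^ (rk vmax - rk x)

end GLG

namespace GLG

variable {V E : Type}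

/-- Tail map of `Γ^e`: the new edge `none` has tail `v`. -/
def extTl (tl : E → V) (v : V) : Option E → V
  | none => v
  | some f => tl f

/-- Head map of `Γ^e`: the new edge `none` has head `w`. -/
def extHd (hd : E → V) (w : V) : Option E → V
  | none => w
  | some f => hd f

/-- The map on generators inducing `A(i^e) : A(Γ) → A(Γ^e)`: `a_j(f) ↦ a_j(f)` for
every `f ∈ E`. -/
noncomputable def extGen (F : Type) [Field F] (tl hd : E → V) (rk : V → ℕ) (v w : V) :
    ESharp tl hd rk → FreeAlgebra F (ESharp (extTl tl v) (extHd hd w) rk) :=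
  fun s => FreeAlgebra.ι F ⟨some s.1, ⟨s.2.1, s.2.2.1, s.2.2.2⟩⟩

end GLG

namespace GLG

theorem reaches_single {V E : Type} (tl hd : E → V) (e : E) : Reaches tl hd (tl e) (hd e) :=
  ⟨e, [], List.isChain_singleton e, rfl, rfl⟩

theorem reaches_cons {V E : Type} (tl hd : E → V) (e : E) {b : V}
    (h : Reaches tl hd (hd e) b) : Reaches tl hd (tl e) b := by
  obtain ⟨f, fs, hp, ht, hb⟩ := h
  refine ⟨e, f :: fs, List.isChain_cons_cons.2 ⟨ht.symm, hp⟩, rfl, ?_⟩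
  rw [← hb]
  simp [pathDst]

theorem reaches_induct {V E : Type} (tl hd : E → V) {P : V → V → Prop}
    (h1 : ∀ e, P (tl e) (hd e)) (h2 : ∀ e b, Reaches tl hd (hd e) b → P (hd e) b → P (tl e) b)
    {a b : V} (h : Reaches tl hd a b) : P a b := by
  obtain ⟨e, es, hp, rfl, rfl⟩ := h
  induction es generalizing e with
  | nil => exact h1 e
  | cons f fs ih =>
    have hp' := List.isChain_cons_cons.1 hp
    have hd' : pathDst hd e (f :: fs) = pathDst hd f fs := by simp [pathDst]
    rw [hd']
    have := ih f hp'.2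
    apply h2 e
    · exact ⟨f, fs, hp'.2, hp'.1.symm, rfl⟩
    · rw [hp'.1]; exact this

theorem reaches_trans {V E : Type} (tl hd : E → V) {a b c : V}
    (h : Reaches tl hd a b) (h' : Reaches tl hd b c) : Reaches tl hd a c := by
  revert h'
  refine reaches_induct tl hd (P := fun a b => Reaches tl hd b c → Reaches tl hd a c) ?_ ?_ h
  · intro e he; exact reaches_cons tl hd e he
  · intro e b _ ih hb; exact reaches_cons tl hd e (ih hb)

theorem reaches_rk {V E : Type} (tl hd : E → V) (rk : V → ℕ) (hr : IsRank tl hd rk) {a b : V}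
    (h : Reaches tl hd a b) : rk b < rk a := by
  refine reaches_induct tl hd (P := fun a b => rk b < rk a) hr ?_ h
  intro e b _ ih
  exact ih.trans (hr e)

theorem ge_rk {V E : Type} (tl hd : E → V) (rk : V → ℕ) (hr : IsRank tl hd rk) {a b : V}
    (h : GE tl hd a b) : rk b ≤ rk a := by
  rcases h with rfl | h
  · exact le_rfl
  · exact (reaches_rk tl hd rk hr h).le

theorem reaches_ext {V E : Type} (tl hd : E → V) (v w : V) {a b : V} :
    Reaches (extTl tl v) (extHd hd w) a b ↔
      Reaches tl hd a b ∨ (GE tl hd a v ∧ GE tl hd w b) := by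
  have mono : ∀ {a b}, Reaches tl hd a b → Reaches (extTl tl v) (extHd hd w) a b := by
    intro a b h
    refine reaches_induct tl hd (P := Reaches (extTl tl v) (extHd hd w)) ?_ ?_ h
    · intro e; exact reaches_single (extTl tl v) (extHd hd w) (some e)
    · intro e b _ ih; exact reaches_cons (extTl tl v) (extHd hd w) (some e) ih
  constructor
  · intro h
    refine reaches_induct (extTl tl v) (extHd hd w)
      (P := fun a b => Reaches tl hd a b ∨ (GE tl hd a v ∧ GE tl hd w b)) ?_ ?_ h
    · rintro (_ | e)
      · exact Or.inr ⟨Or.inl rfl, Or.inl rfl⟩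
      · exact Or.inl (reaches_single tl hd e)
    · rintro (_ | e) b _ ih
      · rcases ih with ih | ih
        · exact Or.inr ⟨Or.inl rfl, Or.inr ih⟩
        · exact Or.inr ⟨Or.inl rfl, ih.2⟩
      · rcases ih with ih | ih
        · exact Or.inl (reaches_cons tl hd e ih)
        · refine Or.inr ⟨?_, ih.2⟩
          rcases ih.1 with h | h
          · exact Or.inr (h ▸ reaches_single tl hd e)
          · exact Or.inr (reaches_cons tl hd e h)
  · rintro (h | ⟨h1, h2⟩)
    · exact mono h
    · have e0 : Reaches (extTl tl v) (extHd hd w) v w :=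
        reaches_single (extTl tl v) (extHd hd w) none
      have e1 : Reaches (extTl tl v) (extHd hd w) a w := by
        rcases h1 with rfl | h1
        · exact e0
        · exact reaches_trans _ _ (mono h1) e0
      rcases h2 with rfl | h2
      · exact e1
      · exact reaches_trans _ _ e1 (mono h2)

/-- nonempty chains -/
def chains {V : Type} (R : V → V → Prop) : Set (List V) := {c | c ≠ [] ∧ c.IsChain R}

theorem chains_finite {V : Type} [Fintype V] (R : V → V → Prop) (rk : V → ℕ)
    (hR : ∀ a b, R a b → rk b < rk a) : (chains R).Finite := by
  classical
  have : {l : List V | l.Nodup}.Finite :=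
    Set.finite_coe_iff.1 (inferInstanceAs (Finite {l : List V // l.Nodup}))
  refine this.subset ?_
  rintro c ⟨-, hc⟩
  have h1 : c.IsChain (fun a b => rk b < rk a) := hc.imp hR
  haveI : IsTrans V (fun a b => rk b < rk a) := ⟨fun a b c h h' => h'.trans h⟩
  have h2 := List.isChain_iff_pairwise.1 h1
  exact h2.imp (fun {a b} h hab => by subst hab; exact lt_irrefl _ h)

theorem chain_ge {V E : Type} (tl hd : E → V) (a d : V) (c : List V)
    (h : (a :: c).IsChain (Reaches tl hd)) : GE tl hd a ((a :: c).getLastD d) := by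
  induction c generalizing a with
  | nil => exact Or.inl rfl
  | cons b t ih =>
    have h' := List.isChain_cons_cons.1 h
    have := ih b h'.2
    have e : (a :: b :: t).getLastD d = (b :: t).getLastD d := by simp [List.getLastD_eq_getLast?]
    rw [e]
    rcases this with h2 | h2
    · rw [← h2]; exact Or.inr h'.1
    · exact Or.inr (reaches_trans _ _ h'.1 h2)

theorem MGamma_eq {V E : Type} [Fintype V] (tl hd : E → V) (rk : V → ℕ)
    (hr : IsRank tl hd rk) (v w : V) :
    MGamma tl hd rk = ∑ᶠ c ∈ chains (Reaches tl hd),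
      (-1 : PowerSeries ℤ) ^ (c.length + 1) *
        (PowerSeries.X : PowerSeries ℤ) ^ (rk (c.headD v) - rk (c.getLastD w)) := by
  classical
  have hfin := chains_finite (Reaches tl hd) rk (fun a b h => reaches_rk tl hd rk hr h)
  have hG : {p : V × V | GE tl hd p.1 p.2}.Finite := Set.toFinite _
  have hmob : ∀ p : V × V, mob tl hd p.1 p.2 =
      ∑ c ∈ hfin.toFinset with (c.headD v, c.getLastD w) = p, (-1 : ℤ) ^ (c.length + 1) := by
    intro p
    unfold mob
    rw [← finsum_mem_coe_finset]
    apply finsum_mem_congr _ (fun _ _ => rfl)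
    ext c
    simp only [Set.mem_setOf_eq, Finset.coe_filter, Set.Finite.mem_toFinset, chains, Prod.ext_iff]
    constructor
    · rintro ⟨h1, h2, h3⟩
      refine ⟨⟨?_, h1⟩, ?_, ?_⟩
      · rintro rfl; simp at h2
      · rw [List.headD_eq_head?_getD, h2]; rfl
      · rw [List.getLastD_eq_getLast?, h3]; rfl
    · rintro ⟨⟨h0, h1⟩, h2, h3⟩
      refine ⟨h1, ?_, ?_⟩
      · rw [← h2, List.headD_eq_head?_getD, List.head?_eq_some_head h0]; rfl
      · rw [← h3, List.getLastD_eq_getLast?, List.getLast?_eq_some_getLast h0]; rfl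
  unfold MGamma
  rw [finsum_mem_eq_finite_toFinset_sum _ hG, finsum_mem_eq_finite_toFinset_sum _ hfin,
    ← Finset.sum_fiberwise_of_maps_to (t := hG.toFinset)
      (g := fun c : List V => (c.headD v, c.getLastD w))]
  · refine Finset.sum_congr rfl fun p _ => ?_
    rw [hmob p, Finset.sum_smul]
    refine Finset.sum_congr rfl fun c hc => ?_
    have := (Finset.mem_filter.1 hc).2
    rw [← this, zsmul_eq_mul]
    push_cast
    rfl
  · intro c hc
    rw [Set.Finite.mem_toFinset] at hc ⊢
    obtain ⟨h0, h1⟩ := hc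
    cases c with
    | nil => exact absurd rfl h0
    | cons a c => exact chain_ge tl hd a w c h1

theorem chain_low {V E : Type} (tl hd : E → V) (rk : V → ℕ) (hr : IsRank tl hd rk) (v w : V)
    (hvw : rk w < rk v) (b : V) (t : List V) (hb : GE tl hd w b)
    (h : (b :: t).IsChain (Reaches (extTl tl v) (extHd hd w))) :
    (b :: t).IsChain (Reaches tl hd) := by
  induction t generalizing b with
  | nil => simp
  | cons c t ih =>
    have h' := List.isChain_cons_cons.1 h
    have hR : Reaches tl hd b c := by
      rcases (reaches_ext tl hd v w).1 h'.1 with h1 | h1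
      · exact h1
      · have := ge_rk tl hd rk hr h1.1
        have := ge_rk tl hd rk hr hb
        omega
    refine List.isChain_cons_cons.2 ⟨hR, ih c ?_ h'.2⟩
    rcases hb with rfl | hb
    · exact Or.inr hR
    · exact Or.inr (reaches_trans _ _ hb hR)

theorem chain_split {V E : Type} (tl hd : E → V) (rk : V → ℕ) (hr : IsRank tl hd rk) (v w : V)
    (hvw : rk w < rk v) (c : List V)
    (h : c.IsChain (Reaches (extTl tl v) (extHd hd w))) (hn : ¬ c.IsChain (Reaches tl hd)) :
    ∃ l a b m, c = (l ++ [a]) ++ b :: m ∧ (l ++ [a]).IsChain (Reaches tl hd) ∧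
      (b :: m).IsChain (Reaches tl hd) ∧ GE tl hd a v ∧ GE tl hd w b ∧ ¬ Reaches tl hd a b := by
  induction c with
  | nil => simp at hn
  | cons a t ih =>
    cases t with
    | nil => simp at hn
    | cons b t =>
      have h' := List.isChain_cons_cons.1 h
      by_cases hR : Reaches tl hd a b
      · obtain ⟨l, x, y, m, e, h1, h2, h3, h4, h5⟩ :=
          ih h'.2 (fun hc => hn (List.isChain_cons_cons.2 ⟨hR, hc⟩))
        refine ⟨a :: l, x, y, m, by rw [e]; rfl, ?_, h2, h3, h4, h5⟩
        cases l with
        | nil =>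
          simp only [List.nil_append, List.singleton_append, List.cons.injEq] at e
          simp [← e.1, hR]
        | cons z l =>
          simp only [List.cons_append, List.cons.injEq] at e
          simp only [List.cons_append] at h1 ⊢
          exact List.isChain_cons_cons.2 ⟨e.1 ▸ hR, h1⟩
      · have h1 := ((reaches_ext tl hd v w).1 h'.1).resolve_left hR
        exact ⟨[], a, b, t, rfl, by simp, chain_low tl hd rk hr v w hvw b t h1.2 h'.2,
          h1.1, h1.2, hR⟩

theorem split_inj_aux {V : Type} (R : V → V → Prop) (v w : V) (l m l' m' k : List V)
    (hl : l ≠ []) (hl' : l'.IsChain R) (hn : ¬ R (l.getLastD v) (m.headD w))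
    (e1 : l' = l ++ k) (e2 : m = k ++ m') : k = [] := by
  by_contra hk
  apply hn
  subst e1 e2
  obtain ⟨x, k, rfl⟩ := List.exists_cons_of_ne_nil hk
  rw [List.isChain_append] at hl'
  refine hl'.2.2 _ ?_ _ ?_
  · rw [List.getLastD_eq_getLast?, List.getLast?_eq_some_getLast hl]; rfl
  · simp

end GLG

/-- **Proposition 5.2.** Let `Γ` be a finite generalized layered graph, let
`v, w` be vertices with `|v| > |w|`, and let `Γ^e` be obtained from `Γ` by adjoining a new
edge `e` with `t(e) = v`, `h(e) = w`.  Then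
`M(Γ^e)(z) - M(Γ)(z) = Σ (-1)^{l+m+1} z^{|v₁| - |w_m|}`, where the sum runs over all pairs
of chains `v₁ > ⋯ > v_l` and `w₁ > ⋯ > w_m` (`l, m ≥ 1`) in the poset of `Γ` such that
`v_l ≥ v`, `w ≥ w₁`, and there is no directed path in `Γ` from `v_l` to `w₁`. -/
theorem MGamma_add_edge {V E : Type} [Fintype V] [Fintype E]
    (tl hd : E → V) (rk : V → ℕ) (hrank : GLG.IsRank tl hd rk)
    (v w : V) (hvw : rk w < rk v) :
    GLG.MGamma (GLG.extTl tl v) (GLG.extHd hd w) rk - GLG.MGamma tl hd rk =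
      ∑ᶠ p ∈ {p : List V × List V |
          p.1 ≠ [] ∧ p.2 ≠ [] ∧
          p.1.Chain' (GLG.Reaches tl hd) ∧ p.2.Chain' (GLG.Reaches tl hd) ∧
          GLG.GE tl hd (p.1.getLastD v) v ∧ GLG.GE tl hd w (p.2.headD w) ∧
          ¬ GLG.Reaches tl hd (p.1.getLastD v) (p.2.headD w)},
        (-1 : PowerSeries ℤ) ^ (p.1.length + p.2.length + 1) *
          (PowerSeries.X : PowerSeries ℤ) ^ (rk (p.1.headD v) - rk (p.2.getLastD w)) := by
  classical
  have hr' : GLG.IsRank (GLG.extTl tl v) (GLG.extHd hd w) rk := by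
    rintro (_ | e)
    · exact hvw
    · exact hrank e
  have hfin := GLG.chains_finite (GLG.Reaches (GLG.extTl tl v) (GLG.extHd hd w)) rk
    (fun a b h => GLG.reaches_rk _ _ rk hr' h)
  have hsub : GLG.chains (GLG.Reaches tl hd) ⊆
      GLG.chains (GLG.Reaches (GLG.extTl tl v) (GLG.extHd hd w)) := by
    rintro c ⟨h0, h1⟩
    exact ⟨h0, h1.imp (fun a b h => (GLG.reaches_ext tl hd v w).2 (Or.inl h))⟩
  rw [GLG.MGamma_eq _ _ rk hr' v w, GLG.MGamma_eq _ _ rk hrank v w,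
    ← finsum_mem_add_sdiff hsub hfin, add_sub_cancel_left]
  symm
  apply finsum_mem_eq_of_bijOn (fun p : List V × List V => p.1 ++ p.2)
  · refine ⟨?_, ?_, ?_⟩
    · rintro ⟨l, m⟩ ⟨h1, h2, h3, h4, h5, h6, h7⟩
      dsimp only at h1 h2 h3 h4 h5 h6 h7 ⊢
      have el : l.getLast? = some (l.getLastD v) := by
        rw [List.getLastD_eq_getLast?, List.getLast?_eq_some_getLast h1]; rfl
      have em : m.head? = some (m.headD w) := by
        rw [List.headD_eq_head?_getD, List.head?_eq_some_head h2]; rfl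
      refine ⟨⟨by simp [h1], ?_⟩, ?_⟩
      · rw [List.isChain_append]
        refine ⟨List.IsChain.imp (fun a b h => (GLG.reaches_ext tl hd v w).2 (Or.inl h)) h3,
          List.IsChain.imp (fun a b h => (GLG.reaches_ext tl hd v w).2 (Or.inl h)) h4, ?_⟩
        intro x hx y hy
        rw [el] at hx
        rw [em] at hy
        cases hx
        cases hy
        exact (GLG.reaches_ext tl hd v w).2 (Or.inr ⟨h5, h6⟩)
      · rintro ⟨-, h⟩
        rw [List.isChain_append] at h
        exact h7 (h.2.2 _ el _ em)
    · rintro ⟨l, m⟩ ⟨h1, h2, h3, h4, h5, h6, h7⟩ ⟨l', m'⟩ ⟨h1', h2', h3', h4', h5', h6', h7'⟩ e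
      dsimp only at h1 h2 h3 h4 h5 h6 h7 h1' h2' h3' h4' h5' h6' h7' e
      rcases List.append_eq_append_iff.1 e with ⟨k, e1, e2⟩ | ⟨k, e1, e2⟩
      · have := GLG.split_inj_aux _ v w l m l' m' k h1 h3' h7 e1 e2
        subst this
        simp [e1, e2]
      · have := GLG.split_inj_aux _ v w l' m' l m k h1' h3 h7' e1 e2
        subst this
        simp [e1, e2]
    · rintro c ⟨⟨h0, h1⟩, h2⟩
      obtain ⟨l, a, b, m, e, h3, h4, h5, h6, h7⟩ :=
        GLG.chain_split tl hd rk hrank v w hvw c h1 (fun h => h2 ⟨h0, h⟩)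
      refine ⟨(l ++ [a], b :: m), ⟨by simp, by simp, h3, h4, ?_, h6, ?_⟩, e.symm⟩
      · simpa [List.getLastD_eq_getLast?] using h5
      · simpa [List.getLastD_eq_getLast?] using h7
  · rintro ⟨l, m⟩ ⟨h1, h2, -⟩
    dsimp only at h1 h2 ⊢
    obtain ⟨a, l, rfl⟩ := List.exists_cons_of_ne_nil h1
    have : (a :: l ++ m).getLastD w = m.getLastD w := by
      simp only [List.getLastD_eq_getLast?, List.getLast?_append,
        List.getLast?_eq_some_getLast h2, Option.some_or]
    rw [this, List.length_append]
    rfl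
end

section
/- Let Γ_1 and Γ_2 be finite generalized layered graphs with unique minimal vertices *_1 and *_2, both of rank 0, and let Γ_1 ∨ Γ_2 be the bouquet obtained from the disjoint union of Γ_1 and Γ_2 by identifying *_1 with *_2. Then M(Γ_1 ∨ Γ_2)(z) = M(Γ_1)(z) + M(Γ_2)(z) − 1. -/
open scoped BigOperators

namespace GLG

variable {V1 E1 V2 E2 : Type}

/-- Vertex set of the bouquet `Γ₁ ∨ Γ₂`: the vertices of `Γ₁` other than `*₁`, the vertices
of `Γ₂` other than `*₂`, and the common minimal vertex `none`. -/
abbrev BqV (V1 V2 : Type) (s1 : V1) (s2 : V2) : Type :=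
  Option ({v : V1 // v ≠ s1} ⊕ {v : V2 // v ≠ s2})

open Classical in
/-- The embedding of the vertices of `Γ₁` into the bouquet. -/
noncomputable def bqEmb1 (s1 : V1) (s2 : V2) : V1 → BqV V1 V2 s1 s2 :=
  fun v => if h : v = s1 then none else some (Sum.inl ⟨v, h⟩)

open Classical in
/-- The embedding of the vertices of `Γ₂` into the bouquet. -/
noncomputable def bqEmb2 (s1 : V1) (s2 : V2) : V2 → BqV V1 V2 s1 s2 :=
  fun v => if h : v = s2 then none else some (Sum.inr ⟨v, h⟩)

/-- Tail map of the bouquet. -/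
noncomputable def bqTl (tl1 : E1 → V1) (tl2 : E2 → V2) (s1 : V1) (s2 : V2) :
    E1 ⊕ E2 → BqV V1 V2 s1 s2 :=
  Sum.elim (fun e => bqEmb1 s1 s2 (tl1 e)) (fun e => bqEmb2 s1 s2 (tl2 e))

/-- Head map of the bouquet. -/
noncomputable def bqHd (hd1 : E1 → V1) (hd2 : E2 → V2) (s1 : V1) (s2 : V2) :
    E1 ⊕ E2 → BqV V1 V2 s1 s2 :=
  Sum.elim (fun e => bqEmb1 s1 s2 (hd1 e)) (fun e => bqEmb2 s1 s2 (hd2 e))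

/-- Rank function of the bouquet. -/
def bqRk (rk1 : V1 → ℕ) (rk2 : V2 → ℕ) (s1 : V1) (s2 : V2) : BqV V1 V2 s1 s2 → ℕ
  | none => 0
  | some (Sum.inl v) => rk1 v.1
  | some (Sum.inr v) => rk2 v.1

theorem bqRk_emb1 {rk1 : V1 → ℕ} {rk2 : V2 → ℕ} {s1 : V1} {s2 : V2} (hs1 : rk1 s1 = 0)
    (v : V1) : bqRk rk1 rk2 s1 s2 (bqEmb1 s1 s2 v) = rk1 v := by
  unfold bqEmb1
  split_ifs with h
  · subst h; exact hs1.symm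
  · rfl

theorem bqRk_emb2 {rk1 : V1 → ℕ} {rk2 : V2 → ℕ} {s1 : V1} {s2 : V2} (hs2 : rk2 s2 = 0)
    (v : V2) : bqRk rk1 rk2 s1 s2 (bqEmb2 s1 s2 v) = rk2 v := by
  unfold bqEmb2
  split_ifs with h
  · subst h; exact hs2.symm
  · rfl

/-- The map on generators inducing the canonical homomorphism `A(Γ₁) → A(Γ₁ ∨ Γ₂)`. -/
noncomputable def bqGen1 (F : Type) [Field F] (tl1 hd1 : E1 → V1) (rk1 : V1 → ℕ)
    (tl2 hd2 : E2 → V2) (rk2 : V2 → ℕ) (s1 : V1) (s2 : V2) (hs1 : rk1 s1 = 0) :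
    ESharp tl1 hd1 rk1 →
      FreeAlgebra F (ESharp (bqTl tl1 tl2 s1 s2) (bqHd hd1 hd2 s1 s2) (bqRk rk1 rk2 s1 s2)) :=
  fun s => FreeAlgebra.ι F ⟨Sum.inl s.1, ⟨s.2.1, s.2.2.1, by
    have h := s.2.2.2
    unfold len at h ⊢
    rw [show bqTl tl1 tl2 s1 s2 (Sum.inl s.1) = bqEmb1 s1 s2 (tl1 s.1) from rfl,
      show bqHd hd1 hd2 s1 s2 (Sum.inl s.1) = bqEmb1 s1 s2 (hd1 s.1) from rfl,
      bqRk_emb1 hs1, bqRk_emb1 hs1]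
    exact h⟩⟩

/-- The map on generators inducing the canonical homomorphism `A(Γ₂) → A(Γ₁ ∨ Γ₂)`. -/
noncomputable def bqGen2 (F : Type) [Field F] (tl1 hd1 : E1 → V1) (rk1 : V1 → ℕ)
    (tl2 hd2 : E2 → V2) (rk2 : V2 → ℕ) (s1 : V1) (s2 : V2) (hs2 : rk2 s2 = 0) :
    ESharp tl2 hd2 rk2 →
      FreeAlgebra F (ESharp (bqTl tl1 tl2 s1 s2) (bqHd hd1 hd2 s1 s2) (bqRk rk1 rk2 s1 s2)) :=
  fun s => FreeAlgebra.ι F ⟨Sum.inr s.1, ⟨s.2.1, s.2.2.1, by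
    have h := s.2.2.2
    unfold len at h ⊢
    rw [show bqTl tl1 tl2 s1 s2 (Sum.inr s.1) = bqEmb2 s1 s2 (tl2 s.1) from rfl,
      show bqHd hd1 hd2 s1 s2 (Sum.inr s.1) = bqEmb2 s1 s2 (hd2 s.1) from rfl,
      bqRk_emb2 hs2, bqRk_emb2 hs2]
    exact h⟩⟩

end GLG

namespace GLG

def Stp {V E : Type} (tl hd : E → V) (v w : V) : Prop := ∃ e, tl e = v ∧ hd e = w

theorem reaches_iff {V E : Type} (tl hd : E → V) (v w : V) :
    Reaches tl hd v w ↔ Relation.TransGen (Stp tl hd) v w := by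
  constructor
  · rintro ⟨e, es, hp, rfl, rfl⟩
    induction es generalizing e with
    | nil => exact Relation.TransGen.single ⟨e, rfl, rfl⟩
    | cons a l ih =>
      unfold IsPathC List.Chain at hp ih
      rw [List.isChain_cons_cons] at hp
      have := ih a hp.2
      exact Relation.TransGen.head ⟨e, rfl, hp.1⟩ (by simpa [pathDst] using this)
  · intro h
    induction h using Relation.TransGen.head_induction_on with
    | single h =>
      obtain ⟨e, h1, h2⟩ := h
      exact ⟨e, [], by simp [IsPathC, List.Chain], h1, by simpa [pathDst] using h2⟩
    | head h _ ih =>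
      obtain ⟨e, h1, h2⟩ := h
      obtain ⟨a, l, h3, h4, h5⟩ := ih
      refine ⟨e, a :: l, ?_, h1, by simpa [pathDst] using h5⟩
      unfold IsPathC List.Chain at h3 ⊢
      rw [List.isChain_cons_cons]
      exact ⟨h2.trans h4.symm, h3⟩

section
variable {V E V' E' : Type} {tl hd : E → V} {tl' hd' : E' → V'} {f : V → V'}

theorem reaches_emb
    (H : ∀ v y, Stp tl' hd' (f v) y ↔ ∃ w, f w = y ∧ Stp tl hd v w) (v : V) (y : V') :
    Reaches tl' hd' (f v) y ↔ ∃ w, f w = y ∧ Reaches tl hd v w := by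
  simp only [reaches_iff]
  constructor
  · intro h
    induction h with
    | single h =>
      obtain ⟨w, h1, h2⟩ := (H _ _).1 h
      exact ⟨w, h1, .single h2⟩
    | tail _ h ih =>
      obtain ⟨w, rfl, h2⟩ := ih
      obtain ⟨u, h3, h4⟩ := (H _ _).1 h
      exact ⟨u, h3, h2.tail h4⟩
  · rintro ⟨w, rfl, h⟩
    exact Relation.TransGen.lift f (fun a b hab => (H _ _).2 ⟨b, rfl, hab⟩) _ _ h

theorem chain_emb
    (H : ∀ v y, Reaches tl' hd' (f v) y ↔ ∃ w, f w = y ∧ Reaches tl hd v w) (v : V)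
    (l : List V') (h : List.IsChain (Reaches tl' hd') (f v :: l)) :
    ∃ m : List V, m.map f = l ∧ List.IsChain (Reaches tl hd) (v :: m) := by
  induction l generalizing v with
  | nil => exact ⟨[], rfl, by simp⟩
  | cons a l ih =>
    rw [List.isChain_cons_cons] at h
    obtain ⟨w, rfl, hw⟩ := (H _ _).1 h.1
    obtain ⟨m, rfl, hm⟩ := ih w h.2
    exact ⟨w :: m, rfl, by rw [List.isChain_cons_cons]; exact ⟨hw, hm⟩⟩

theorem mob_emb (hf : Function.Injective f)
    (H : ∀ v y, Reaches tl' hd' (f v) y ↔ ∃ w, f w = y ∧ Reaches tl hd v w) (v w : V) :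
    mob tl' hd' (f v) (f w) = mob tl hd v w := by
  unfold mob
  symm
  refine finsum_mem_eq_of_bijOn (List.map f) ⟨?_, ?_, ?_⟩ ?_
  · rintro c ⟨h1, h2, h3⟩
    refine ⟨?_, by simp [h2], by simp [h3]⟩
    show List.IsChain _ _
    rw [List.isChain_map]
    exact List.IsChain.imp (fun a b hab => (H _ _).2 ⟨b, rfl, hab⟩) h1
  · exact (List.map_injective_iff.2 hf).injOn
  · rintro c ⟨h1, h2, h3⟩
    cases c with
    | nil => simp at h2
    | cons a l =>
      simp only [List.head?_cons, Option.some.injEq] at h2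
      subst h2
      obtain ⟨m, rfl, hm⟩ := chain_emb H v l h1
      refine ⟨v :: m, ⟨hm, rfl, ?_⟩, rfl⟩
      rw [← List.map_cons, List.getLast?_map] at h3
      exact Option.map_injective hf (by simpa using h3)
  · intro c _
    simp

theorem ge_emb
    (H : ∀ v y, Reaches tl' hd' (f v) y ↔ ∃ w, f w = y ∧ Reaches tl hd v w) (v : V) (y : V') :
    GE tl' hd' (f v) y ↔ ∃ w, f w = y ∧ GE tl hd v w := by
  unfold GE
  rw [H]
  constructor
  · rintro (h | ⟨w, h, h'⟩)
    · exact ⟨v, h, .inl rfl⟩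
    · exact ⟨w, h, .inr h'⟩
  · rintro ⟨w, h, rfl | h'⟩
    · exact .inl h
    · exact .inr ⟨w, h, h'⟩

theorem MGamma_emb (hf : Function.Injective f)
    (H : ∀ v y, Reaches tl' hd' (f v) y ↔ ∃ w, f w = y ∧ Reaches tl hd v w)
    (rk : V → ℕ) (rk' : V' → ℕ) (hrk : ∀ v, rk' (f v) = rk v) :
    ∑ᶠ p ∈ Prod.map f f '' {p : V × V | GE tl hd p.1 p.2},
      mob tl' hd' p.1 p.2 • (PowerSeries.X : PowerSeries ℤ) ^ (rk' p.1 - rk' p.2) =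
    MGamma tl hd rk := by
  rw [finsum_mem_image (hf.prodMap hf).injOn]
  unfold MGamma
  simp only [Prod.map_fst, Prod.map_snd, mob_emb hf H, hrk]

end

theorem not_reaches_min {V E : Type} {tl hd : E → V} {s : V} (h : ∀ e, tl e ≠ s) (w : V) :
    ¬ Reaches tl hd s w := by
  rintro ⟨e, _, _, h1, _⟩
  exact h e h1

theorem mob_min {V E : Type} {tl hd : E → V} {s : V} (h : ∀ e, tl e ≠ s) :
    mob tl hd s s = 1 := by
  unfold mob
  have : {c : List V | c.IsChain (Reaches tl hd) ∧ c.head? = some s ∧ c.getLast? = some s}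
      = {[s]} := by
    ext c
    constructor
    · rintro ⟨h1, h2, h3⟩
      match c, h1, h2 with
      | [a], _, h2 => simpa using h2
      | a :: b :: l, h1, h2 =>
        simp only [List.head?_cons, Option.some.injEq] at h2
        subst h2
        rw [List.isChain_cons_cons] at h1
        exact absurd h1.1 (not_reaches_min h b)
    · rintro rfl
      simp
  erw [this]
  rw [finsum_mem_singleton]
  simp

section
variable {V1 E1 V2 E2 : Type} {s1 : V1} {s2 : V2}

theorem emb1_inj : Function.Injective (bqEmb1 s1 s2) := by
  intro a b h
  unfold bqEmb1 at h
  split_ifs at h <;> simp_all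

theorem emb2_inj : Function.Injective (bqEmb2 s1 s2) := by
  intro a b h
  unfold bqEmb2 at h
  split_ifs at h <;> simp_all

theorem emb_eq {a : V1} {b : V2} (h : bqEmb1 s1 s2 a = bqEmb2 s1 s2 b) : a = s1 ∧ b = s2 := by
  unfold bqEmb1 bqEmb2 at h
  split_ifs at h <;> simp_all

theorem emb1_s : bqEmb1 s1 s2 s1 = none := by simp [bqEmb1]
theorem emb2_s : bqEmb2 s1 s2 s2 = none := by simp [bqEmb2]

theorem emb_cover (x : BqV V1 V2 s1 s2) :
    (∃ a, bqEmb1 s1 s2 a = x) ∨ (∃ b, bqEmb2 s1 s2 b = x) := by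
  match x with
  | none => exact .inl ⟨s1, emb1_s⟩
  | some (Sum.inl v) => exact .inl ⟨v.1, by simp [bqEmb1, v.2]⟩
  | some (Sum.inr v) => exact .inr ⟨v.1, by simp [bqEmb2, v.2]⟩

theorem stp1 (tl1 hd1 : E1 → V1) (tl2 hd2 : E2 → V2) (h2 : ∀ e, tl2 e ≠ s2) (v : V1)
    (y : BqV V1 V2 s1 s2) :
    Stp (bqTl tl1 tl2 s1 s2) (bqHd hd1 hd2 s1 s2) (bqEmb1 s1 s2 v) y ↔
      ∃ w, bqEmb1 s1 s2 w = y ∧ Stp tl1 hd1 v w := by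
  constructor
  · rintro ⟨e | e, h, h'⟩
    · exact ⟨hd1 e, h', e, emb1_inj h, rfl⟩
    · exact absurd (emb_eq h.symm).2 (h2 e)
  · rintro ⟨w, rfl, e, rfl, rfl⟩
    exact ⟨.inl e, rfl, rfl⟩

theorem stp2 (tl1 hd1 : E1 → V1) (tl2 hd2 : E2 → V2) (h1 : ∀ e, tl1 e ≠ s1) (v : V2)
    (y : BqV V1 V2 s1 s2) :
    Stp (bqTl tl1 tl2 s1 s2) (bqHd hd1 hd2 s1 s2) (bqEmb2 s1 s2 v) y ↔
      ∃ w, bqEmb2 s1 s2 w = y ∧ Stp tl2 hd2 v w := by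
  constructor
  · rintro ⟨e | e, h, h'⟩
    · exact absurd (emb_eq h).1 (h1 e)
    · exact ⟨hd2 e, h', e, emb2_inj h, rfl⟩
  · rintro ⟨w, rfl, e, rfl, rfl⟩
    exact ⟨.inr e, rfl, rfl⟩

end

end GLG

/-- **Proposition 5.5.** Let `Γ₁`, `Γ₂` be finite generalized layered graphs
with unique minimal vertices `*₁`, `*₂` of rank `0`, and let `Γ₁ ∨ Γ₂` be the bouquet
obtained by identifying `*₁` with `*₂`.  Then
`M(Γ₁ ∨ Γ₂)(z) = M(Γ₁)(z) + M(Γ₂)(z) - 1`. -/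
theorem MGamma_bouquet {V1 E1 V2 E2 : Type}
    [Fintype V1] [Fintype E1] [Fintype V2] [Fintype E2]
    (tl1 hd1 : E1 → V1) (rk1 : V1 → ℕ) (hrank1 : GLG.IsRank tl1 hd1 rk1)
    (tl2 hd2 : E2 → V2) (rk2 : V2 → ℕ) (hrank2 : GLG.IsRank tl2 hd2 rk2)
    (s1 : V1) (hs1 : rk1 s1 = 0) (hmin1 : ∀ v : V1, (∀ e : E1, tl1 e ≠ v) ↔ v = s1)
    (s2 : V2) (hs2 : rk2 s2 = 0) (hmin2 : ∀ v : V2, (∀ e : E2, tl2 e ≠ v) ↔ v = s2) :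
    GLG.MGamma (GLG.bqTl tl1 tl2 s1 s2) (GLG.bqHd hd1 hd2 s1 s2) (GLG.bqRk rk1 rk2 s1 s2) =
      GLG.MGamma tl1 hd1 rk1 + GLG.MGamma tl2 hd2 rk2 - 1 := by
  have m1 : ∀ e, tl1 e ≠ s1 := (hmin1 s1).2 rfl
  have m2 : ∀ e, tl2 e ≠ s2 := (hmin2 s2).2 rfl
  have H1 := GLG.reaches_emb (GLG.stp1 (s1 := s1) (s2 := s2) tl1 hd1 tl2 hd2 m2)
  have H2 := GLG.reaches_emb (GLG.stp2 (s1 := s1) (s2 := s2) tl1 hd1 tl2 hd2 m1)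
  rw [← GLG.MGamma_emb GLG.emb1_inj H1 rk1 (GLG.bqRk rk1 rk2 s1 s2) (GLG.bqRk_emb1 hs1),
    ← GLG.MGamma_emb GLG.emb2_inj H2 rk2 (GLG.bqRk rk1 rk2 s1 s2) (GLG.bqRk_emb2 hs2),
    ← finsum_mem_union_inter (Set.toFinite _) (Set.toFinite _)]
  have hU : {p : GLG.BqV V1 V2 s1 s2 × GLG.BqV V1 V2 s1 s2 |
        GLG.GE (GLG.bqTl tl1 tl2 s1 s2) (GLG.bqHd hd1 hd2 s1 s2) p.1 p.2} =
      Prod.map (GLG.bqEmb1 s1 s2) (GLG.bqEmb1 s1 s2) '' {p | GLG.GE tl1 hd1 p.1 p.2} ∪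
      Prod.map (GLG.bqEmb2 s1 s2) (GLG.bqEmb2 s1 s2) '' {p | GLG.GE tl2 hd2 p.1 p.2} := by
    ext ⟨x, y⟩
    constructor
    · intro h
      rcases GLG.emb_cover x with ⟨a, rfl⟩ | ⟨a, rfl⟩
      · obtain ⟨w, rfl, hw⟩ := (GLG.ge_emb H1 a y).1 h
        exact .inl ⟨(a, w), hw, rfl⟩
      · obtain ⟨w, rfl, hw⟩ := (GLG.ge_emb H2 a y).1 h
        exact .inr ⟨(a, w), hw, rfl⟩
    · rintro (⟨⟨a, w⟩, h, he⟩ | ⟨⟨a, w⟩, h, he⟩)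
      · cases he
        exact (GLG.ge_emb H1 a _).2 ⟨w, rfl, h⟩
      · cases he
        exact (GLG.ge_emb H2 a _).2 ⟨w, rfl, h⟩
  have hI : (Prod.map (GLG.bqEmb1 s1 s2) (GLG.bqEmb1 s1 s2) '' {p | GLG.GE tl1 hd1 p.1 p.2} ∩
      Prod.map (GLG.bqEmb2 s1 s2) (GLG.bqEmb2 s1 s2) '' {p | GLG.GE tl2 hd2 p.1 p.2}) =
      {(none, none)} := by
    ext ⟨x, y⟩
    constructor
    · rintro ⟨⟨⟨a, w⟩, h, he⟩, ⟨⟨b, u⟩, h', he'⟩⟩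
      simp only [Prod.map_apply, Prod.mk.injEq] at he he'
      obtain ⟨rfl, rfl⟩ := he
      obtain ⟨rfl, rfl⟩ := GLG.emb_eq he'.1.symm
      obtain ⟨rfl, rfl⟩ := GLG.emb_eq he'.2.symm
      simp [GLG.emb1_s]
    · intro h
      rw [Set.mem_singleton_iff] at h
      rw [h]
      exact ⟨⟨(s1, s1), .inl rfl, by simp [GLG.emb1_s]⟩, ⟨(s2, s2), .inl rfl, by simp [GLG.emb2_s]⟩⟩
  have hm : GLG.mob (GLG.bqTl tl1 tl2 s1 s2) (GLG.bqHd hd1 hd2 s1 s2) none none = 1 := by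
    rw [← GLG.emb1_s (s1 := s1) (s2 := s2), GLG.mob_emb GLG.emb1_inj H1, GLG.mob_min m1]
  rw [← hU, hI, finsum_mem_singleton]
  simp only [hm]
  simp [GLG.MGamma]
end
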